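/- Let m ≥ 1 be finite and q ∈ C₀^{m+1}([-T_-,T_+]) (m+1 times differentiable with q and all derivatives up to order m+1 compactly supported in Ω and vanishing on ∂Ω). Then β(τ) = F^{-1}[b](τ), where b is the Zakharov–Shabat b-coefficient of q, is supported in [-2T_+,2T_-], is m-times differentiable in (-2T_+,2T_-), and ∂_τ^k β(τ) → 0 as τ → -2T_+⁺ and as τ → 2T_-⁻ for every 0 ≤ k ≤ m. -/

import Mathlib

open MeasureTheory Complex Set Filter

open scoped FourierTransform SchwartzMap ContDiff in
lemma zs_fourier_L2 (R : ℝ → ℂ) (hc : Continuous R) (hs : HasCompactSupport R) :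
    Integrable (fun w => ‖𝓕 R w‖ ^ 2) := by
  have h1 : Integrable R := hc.integrable_of_hasCompactSupport hs
  have h2 : MemLp R 2 := hc.memLp_of_hasCompactSupport hs
  set f : Lp ℂ 2 (volume : Measure ℝ) := h2.toLp R with hf
  set Ff : Lp ℂ 2 (volume : Measure ℝ) := 𝓕 f with hFf
  have hcF : Continuous (𝓕 R) := by
    have := Real.contDiff_fourier (f := R) (N := 0) (fun n hn => by
      have : n = 0 := by simpa using hn
      subst this
      simpa using h1.norm)
    exact this.continuous
  have key : ∀ᵐ x ∂(volume : Measure ℝ), 𝓕 R x = Ff x := by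
    apply ae_eq_of_integral_contDiff_smul_eq
    · exact hcF.locallyIntegrable
    · exact (Lp.memLp Ff).locallyIntegrable (by norm_num)
    intro g g_smooth g_cpt
    have hg₁ : HasCompactSupport (Complex.ofRealCLM ∘ g) := g_cpt.comp_left rfl
    have hg₂ : ContDiff ℝ ∞ (Complex.ofRealCLM ∘ g) := by fun_prop
    set G := hg₁.toSchwartzMap hg₂ with hG
    have e1 : ∫ x, g x • Ff x =
        Lp.toTemperedDistributionCLM ℂ volume 2 Ff G := by simp [hG]
    have e2 : Lp.toTemperedDistributionCLM ℂ volume 2 Ff G = ∫ x, (𝓕 G) x • f x := by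
      rw [Lp.toTemperedDistributionCLM_apply, hFf, ← Lp.fourier_toTemperedDistribution_eq]
      simp
    have e3 : ∫ x, (𝓕 G) x • f x = ∫ x, (𝓕 G) x • R x := by
      apply integral_congr_ae
      filter_upwards [h2.coeFn_toLp] with x hx
      rw [hf, hx]
    have e4 : ∫ x, (𝓕 G) x • R x = ∫ x, G x • 𝓕 R x := by
      have := VectorFourier.integral_fourierIntegral_smul_eq_flip (L := innerₗ ℝ)
        Real.continuous_fourierChar continuous_inner (G.integrable (μ := volume)) h1
      simpa using! this
    rw [e1, e2, e3, e4]
    simp [hG]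
  have := (Lp.memLp Ff).integrable_norm_pow (by norm_num)
  refine this.congr ?_
  filter_upwards [key] with x hx
  rw [hx]

open scoped FourierTransform ContDiff in
/-- if `∫ b * ψ` vanishes for all `ψ = 𝓕 g`, `g` a test function supported in open `U`,
then `𝓕 b = 0` on `U`. -/
lemma zs_fourier_zero (b : ℝ → ℂ) (hb : Integrable b) (hcF : Continuous (𝓕 b))
    (U : Set ℝ) (hU : IsOpen U)
    (h : ∀ φ : ℝ → ℂ, Integrable φ → (∀ w ∈ Uᶜ, ∫ ξ : ℝ, φ ξ * Complex.exp (2 * Real.pi * w * ξ * I) = 0)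
      → ∫ ξ : ℝ, φ ξ * b ξ = 0) :
    ∀ w ∈ U, 𝓕 b w = 0 := by
  have hae : ∀ᵐ x, x ∈ U → 𝓕 b x = 0 := by
    apply hU.ae_eq_zero_of_integral_contDiff_smul_eq_zero
    · exact hcF.locallyIntegrable.locallyIntegrableOn _
    intro g g_smooth g_cpt g_supp
    have hg₁ : HasCompactSupport (Complex.ofRealCLM ∘ g) := g_cpt.comp_left rfl
    have hg₂ : ContDiff ℝ ∞ (Complex.ofRealCLM ∘ g) := by fun_prop
    set G := hg₁.toSchwartzMap hg₂ with hG
    have e4 : ∫ x, (𝓕 G) x • b x = ∫ x, G x • 𝓕 b x := by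
      have := VectorFourier.integral_fourierIntegral_smul_eq_flip (L := innerₗ ℝ)
        Real.continuous_fourierChar continuous_inner (G.integrable (μ := volume)) hb
      simpa using! this
    have e5 : ∫ x, (𝓕 G) x * b x = 0 := by
      apply h _ ((𝓕 G).integrable)
      intro w hw
      have : 𝓕⁻ (𝓕 G) w = 0 := by
        rw [FourierTransform.fourierInv_fourier_eq]
        have : g w = 0 := by
          by_contra hne
          exact hw (g_supp (subset_tsupport _ hne))
        simp [hG, this]
      rw [SchwartzMap.fourierInv_coe, Real.fourierInv_eq'] at this
      rw [← this]
      congr 1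
      ext ξ
      simp only [smul_eq_mul]
      rw [mul_comm]
      congr 2
      simp
      ring
    have : ∫ x, g x • 𝓕 b x = ∫ x, G x • 𝓕 b x := by simp [hG]
    rw [this, ← e4]
    exact e5
  have hD : Dense {x | x ∈ U → 𝓕 b x = 0} := Measure.dense_of_ae hae
  intro w hw
  by_contra hne
  have : IsOpen (U ∩ {x | 𝓕 b x ≠ 0}) := hU.inter (isOpen_ne_fun hcF continuous_const)
  obtain ⟨x, hx1, hx2⟩ := hD.inter_open_nonempty _ this ⟨w, hw, hne⟩
  exact hx1.2 (hx2 hx1.1)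

structure ZSys (Tm K : ℝ) (q r : ℝ → ℂ) (A B : ℝ → ℝ → ℂ) : Prop where
  hTm : 0 ≤ Tm
  hqc : Continuous q
  hK : ∀ t, ‖q t‖ ≤ K
  hr : ∀ t, r t = -(starRingEnd ℂ) (q t)
  hA : ∀ ξ t, HasDerivAt (A ξ) (q t * B ξ t * Complex.exp (2 * Complex.I * ξ * t)) t
  hB : ∀ ξ t, HasDerivAt (B ξ) (r t * A ξ t * Complex.exp (-(2 * Complex.I * ξ * t))) t
  hA0 : ∀ ξ, A ξ (-Tm) = 1
  hB0 : ∀ ξ, B ξ (-Tm) = 0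

lemma zs_norm_exp (ξ t : ℝ) : ‖Complex.exp (2 * Complex.I * ξ * t)‖ = 1 := by
  have : (2 * Complex.I * ξ * t : ℂ) = ((2 * ξ * t : ℝ) : ℂ) * I := by push_cast; ring
  rw [this, Complex.norm_exp_ofReal_mul_I]

lemma zs_norm_exp' (ξ t : ℝ) : ‖Complex.exp (-(2 * Complex.I * ξ * t))‖ = 1 := by
  rw [Complex.exp_neg, norm_inv, zs_norm_exp, inv_one]

lemma zs_conj_exp (ξ t : ℝ) : (starRingEnd ℂ) (Complex.exp (2 * Complex.I * ξ * t)) =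
    Complex.exp (-(2 * Complex.I * ξ * t)) := by
  rw [← Complex.exp_conj]; simp [Complex.conj_ofNat]

lemma zs_conj_exp' (ξ t : ℝ) : (starRingEnd ℂ) (Complex.exp (-(2 * Complex.I * ξ * t))) =
    Complex.exp (2 * Complex.I * ξ * t) := by
  rw [← Complex.exp_conj]; simp [Complex.conj_ofNat]

lemma zs_exp_sub (ξ η t : ℝ) : ‖Complex.exp (2 * Complex.I * ξ * t) -
    Complex.exp (2 * Complex.I * η * t)‖ ≤ 2 * |ξ - η| * |t| := by
  have h1 : Complex.exp (2 * Complex.I * ξ * t) = Complex.exp (2 * Complex.I * η * t) *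
      Complex.exp (I * ((2 * (ξ - η) * t : ℝ) : ℂ)) := by
    rw [← Complex.exp_add]; congr 1; push_cast; ring
  have h2 := Real.norm_exp_I_mul_ofReal_sub_one_le (x := 2 * (ξ - η) * t)
  rw [h1, ← mul_sub_one, norm_mul, zs_norm_exp, one_mul]
  refine h2.trans (le_of_eq ?_)
  rw [Real.norm_eq_abs, abs_mul, abs_mul]; norm_num

namespace ZSys
variable {Tm K : ℝ} {q r : ℝ → ℂ} {A B : ℝ → ℝ → ℂ}

lemma K0 (h : ZSys Tm K q r A B) : 0 ≤ K := (norm_nonneg _).trans (h.hK 0)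

lemma rc (h : ZSys Tm K q r A B) : Continuous r := by
  have : r = fun t => -(starRingEnd ℂ) (q t) := funext h.hr
  rw [this]
  exact (Complex.continuous_conj.comp h.hqc).neg

lemma hKr (h : ZSys Tm K q r A B) (t : ℝ) : ‖r t‖ ≤ K := by
  rw [h.hr, norm_neg, RCLike.norm_conj]; exact h.hK t

lemma Ac (h : ZSys Tm K q r A B) (ξ : ℝ) : Continuous (A ξ) :=
  continuous_iff_continuousAt.2 fun t => (h.hA ξ t).continuousAt

lemma Bc (h : ZSys Tm K q r A B) (ξ : ℝ) : Continuous (B ξ) :=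
  continuous_iff_continuousAt.2 fun t => (h.hB ξ t).continuousAt

lemma wronsk (h : ZSys Tm K q r A B) (ξ η t : ℝ) :
    HasDerivAt (fun t => A ξ t * (starRingEnd ℂ) (A η t) + B ξ t * (starRingEnd ℂ) (B η t))
      (q t * B ξ t * (starRingEnd ℂ) (A η t) *
        (Complex.exp (2 * Complex.I * ξ * t) - Complex.exp (2 * Complex.I * η * t)) -
       (starRingEnd ℂ) (q t) * A ξ t * (starRingEnd ℂ) (B η t) *
        (starRingEnd ℂ) (Complex.exp (2 * Complex.I * ξ * t) - Complex.exp (2 * Complex.I * η * t))) t := by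
  have h1 := ((h.hA ξ t).mul (h.hA η t).star).add ((h.hB ξ t).mul (h.hB η t).star)
  refine h1.congr_deriv ?_
  simp only [Complex.star_def, map_mul, map_sub, zs_conj_exp, zs_conj_exp', h.hr, map_neg,
    Complex.conj_conj]
  ring

lemma norm_sq (h : ZSys Tm K q r A B) (ξ t : ℝ) : ‖A ξ t‖ ^ 2 + ‖B ξ t‖ ^ 2 = 1 := by
  have h1 : ∀ s, HasDerivAt (fun t => A ξ t * (starRingEnd ℂ) (A ξ t) +
      B ξ t * (starRingEnd ℂ) (B ξ t)) 0 s := fun s => by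
    refine (h.wronsk ξ ξ s).congr_deriv ?_
    simp
  have h2 := is_const_of_deriv_eq_zero (fun s => (h1 s).differentiableAt)
    (fun s => (h1 s).deriv) t (-Tm)
  simp only [h.hA0, h.hB0, Complex.mul_conj, Complex.normSq_eq_norm_sq] at h2
  have h3 : ((‖A ξ t‖ ^ 2 + ‖B ξ t‖ ^ 2 : ℝ) : ℂ) = 1 := by
    push_cast at h2 ⊢
    simpa using h2
  exact_mod_cast h3

lemma A1 (h : ZSys Tm K q r A B) (ξ t : ℝ) : ‖A ξ t‖ ≤ 1 := by
  have := h.norm_sq ξ t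
  nlinarith [sq_nonneg ‖B ξ t‖, norm_nonneg (A ξ t)]

lemma B1 (h : ZSys Tm K q r A B) (ξ t : ℝ) : ‖B ξ t‖ ≤ 1 := by
  have := h.norm_sq ξ t
  nlinarith [sq_nonneg ‖A ξ t‖, norm_nonneg (B ξ t)]

lemma wronsk_bound (h : ZSys Tm K q r A B) (ξ η t : ℝ) :
    ‖A ξ t - A η t‖ ^ 2 + ‖B ξ t - B η t‖ ^ 2 ≤
      8 * K * (|t| + Tm) ^ 2 * |ξ - η| := by
  set W := fun t => A ξ t * (starRingEnd ℂ) (A η t) + B ξ t * (starRingEnd ℂ) (B η t) with hW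
  have hb : ‖W t - W (-Tm)‖ ≤ (4 * K * |ξ - η| * (|t| + Tm)) * ‖t - (-Tm)‖ := by
    have hcv : Convex ℝ (Icc (-(|t| + Tm)) (|t| + Tm)) := convex_Icc _ _
    refine hcv.norm_image_sub_le_of_norm_hasDerivWithin_le
      (fun s _ => (h.wronsk ξ η s).hasDerivWithinAt) ?_ ?_ ?_
    · intro s hs
      have hs' : |s| ≤ |t| + Tm := abs_le.2 hs
      have e1 := (zs_exp_sub ξ η s).trans
        (mul_le_mul_of_nonneg_left hs' (by positivity : (0:ℝ) ≤ 2 * |ξ - η|))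
      have hK0 := h.K0
      have a1 := h.A1 ξ s
      have a2 := h.A1 η s
      have b1 := h.B1 ξ s
      have b2 := h.B1 η s
      have hq := h.hK s
      have hTm := h.hTm
      refine (norm_sub_le _ _).trans ?_
      simp only [norm_mul, RCLike.norm_conj]
      calc _ ≤ K * 1 * 1 * (2 * |ξ - η| * (|t| + Tm)) + K * 1 * 1 * (2 * |ξ - η| * (|t| + Tm)) := by
            gcongr
        _ = _ := by ring
    · have := h.hTm
      constructor <;> linarith [abs_nonneg t]
    · have := h.hTm
      constructor <;> linarith [le_abs_self t, neg_abs_le t]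
  have hW0 : W (-Tm) = 1 := by simp [hW, h.hA0, h.hB0]
  have hid : ‖A ξ t - A η t‖ ^ 2 + ‖B ξ t - B η t‖ ^ 2 = 2 - 2 * (W t).re := by
    have e1 := h.norm_sq ξ t
    have e2 := h.norm_sq η t
    simp only [← Complex.normSq_eq_norm_sq, Complex.normSq_sub] at *
    simp only [hW, Complex.add_re]
    linarith
  have h3 : (1 : ℝ) - (W t).re ≤ ‖W t - W (-Tm)‖ := by
    rw [hW0, norm_sub_rev]
    have := Complex.re_le_norm (1 - W t)
    simpa using this
  have h4 : ‖t - (-Tm)‖ ≤ |t| + Tm := by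
    rw [Real.norm_eq_abs, sub_neg_eq_add]
    exact (abs_add_le _ _).trans (by rw [abs_of_nonneg h.hTm])
  have h5 : (4 * K * |ξ - η| * (|t| + Tm)) * ‖t - (-Tm)‖ ≤
      (4 * K * |ξ - η| * (|t| + Tm)) * (|t| + Tm) := by
    have := h.K0
    have := h.hTm
    gcongr
  rw [hid]
  nlinarith

lemma cont_aux (f : ℝ → ℂ) (C : ℝ) (hf : ∀ ξ η, ‖f ξ - f η‖ ^ 2 ≤ C * |ξ - η|) : Continuous f := by
  rw [continuous_iff_continuousAt]
  intro η
  rw [ContinuousAt, tendsto_iff_norm_sub_tendsto_zero]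
  have h1 : Tendsto (fun ξ : ℝ => Real.sqrt (C * |ξ - η|)) (nhds η) (nhds 0) := by
    have : Continuous (fun ξ : ℝ => Real.sqrt (C * |ξ - η|)) := by fun_prop
    simpa using this.tendsto η
  exact squeeze_zero (fun _ => norm_nonneg _) (fun ξ => Real.le_sqrt_of_sq_le (hf ξ η)) h1

lemma Acξ (h : ZSys Tm K q r A B) (t : ℝ) : Continuous (fun ξ => A ξ t) :=
  cont_aux _ _ fun ξ η => (le_add_of_nonneg_right (sq_nonneg _)).trans (h.wronsk_bound ξ η t)

lemma Bcξ (h : ZSys Tm K q r A B) (t : ℝ) : Continuous (fun ξ => B ξ t) :=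
  cont_aux _ _ fun ξ η => (le_add_of_nonneg_left (sq_nonneg _)).trans (h.wronsk_bound ξ η t)

lemma Ameas (h : ZSys Tm K q r A B) : Measurable (fun p : ℝ × ℝ => A p.2 p.1) := by
  have := stronglyMeasurable_uncurry_of_continuous_of_stronglyMeasurable
    (u := fun t ξ => A ξ t) (fun ξ => (h.Ac ξ)) (fun t => (h.Acξ t).stronglyMeasurable)
  exact this.measurable

lemma Bmeas (h : ZSys Tm K q r A B) : Measurable (fun p : ℝ × ℝ => B p.2 p.1) := by
  have := stronglyMeasurable_uncurry_of_continuous_of_stronglyMeasurable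
    (u := fun t ξ => B ξ t) (fun ξ => (h.Bc ξ)) (fun t => (h.Bcξ t).stronglyMeasurable)
  exact this.measurable

lemma spec_step (φ : ℝ → ℂ) (hφ : Integrable φ) (c : ℝ → ℂ) (hc : Continuous c)
    (hcK : ∀ t, ‖c t‖ ≤ K) (G : ℝ → ℝ → ℂ) (hG : Measurable (fun p : ℝ × ℝ => G p.2 p.1))
    (hG1 : ∀ ξ t, ‖G ξ t‖ ≤ 1) (t : ℝ) (ht : -Tm ≤ t) (n : ℕ) (N : ℝ)
    (hb : ∀ y ∈ Icc (-Tm) t, ‖∫ ξ : ℝ, φ ξ * G ξ y‖ ≤ K ^ n * (y + Tm) ^ n / n.factorial * N) :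
    ‖∫ ξ : ℝ, φ ξ * ∫ y in (-Tm)..t, c y * G ξ y‖ ≤
      K ^ (n + 1) * (t + Tm) ^ (n + 1) / (n + 1).factorial * N := by
  have hK0 : 0 ≤ K := (norm_nonneg _).trans (hcK 0)
  have hint : Integrable (Function.uncurry fun (y ξ : ℝ) => φ ξ * (c y * G ξ y))
      ((volume.restrict (Set.uIoc (-Tm) t)).prod volume) := by
    have hfin : IsFiniteMeasure (volume.restrict (Set.uIoc (-Tm) t)) := by
      rw [uIoc_of_le ht]; infer_instance
    have h1 : Integrable (fun p : ℝ × ℝ => (1 : ℂ) * φ p.2)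
        ((volume.restrict (Set.uIoc (-Tm) t)).prod volume) :=
      (integrable_const (1 : ℂ)).mul_prod hφ
    have h2 := h1.bdd_mul (f := fun p : ℝ × ℝ => c p.1 * G p.2 p.1) (c := K)
      ((hc.measurable.comp measurable_fst).mul hG).aestronglyMeasurable
      (Eventually.of_forall fun p => by
        rw [norm_mul]
        calc _ ≤ K * 1 := by gcongr; exact hcK _; exact hG1 _ _
          _ = K := mul_one _)
    refine h2.congr (Eventually.of_forall fun p => ?_)
    simp only [Function.uncurry]; ring
  have hswap := intervalIntegral_integral_swap hint
  simp only [intervalIntegral.integral_const_mul] at hswap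
  rw [← hswap]
  have e : ∀ y, ∫ ξ : ℝ, φ ξ * (c y * G ξ y) = c y * ∫ ξ : ℝ, φ ξ * G ξ y := fun y => by
    rw [← integral_const_mul]; congr 1; ext ξ; ring
  simp only [e]
  have hbound := intervalIntegral.norm_integral_le_of_norm_le (μ := volume)
    (f := fun y => c y * ∫ ξ : ℝ, φ ξ * G ξ y)
    (g := fun y => K * (K ^ n * (y + Tm) ^ n / n.factorial * N)) ht
    (Eventually.of_forall fun y hy => by
      rw [norm_mul]
      have := hb y ⟨hy.1.le, hy.2⟩
      exact mul_le_mul (hcK y) this (norm_nonneg _) hK0)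
    (by apply Continuous.intervalIntegrable; fun_prop)
  refine hbound.trans (le_of_eq ?_)
  have e2 : ∀ y : ℝ, K * (K ^ n * (y + Tm) ^ n / n.factorial * N) =
      (K ^ (n + 1) / n.factorial * N) * (y + Tm) ^ n := fun y => by ring
  simp only [e2, intervalIntegral.integral_const_mul]
  rw [intervalIntegral.integral_comp_add_right (fun y => y ^ n), integral_pow]
  rw [Nat.factorial_succ]
  have := Nat.factorial_pos n
  push_cast
  field_simp
  simp

lemma A_int (h : ZSys Tm K q r A B) (ξ t : ℝ) :
    A ξ t = 1 + ∫ y in (-Tm)..t, q y * (B ξ y * Complex.exp (2 * Complex.I * ξ * y)) := by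
  have hc : Continuous fun y : ℝ => q y * B ξ y * Complex.exp (2 * Complex.I * ξ * y) := by
    have := h.hqc; have := h.Bc ξ; fun_prop
  have := intervalIntegral.integral_eq_sub_of_hasDerivAt (a := -Tm) (b := t)
    (fun y _ => h.hA ξ y) (hc.intervalIntegrable _ _)
  simp only [← mul_assoc]
  rw [this, h.hA0]; ring

lemma B_int (h : ZSys Tm K q r A B) (ξ t : ℝ) :
    B ξ t = ∫ y in (-Tm)..t, r y * (A ξ y * Complex.exp (-(2 * Complex.I * ξ * y))) := by
  have hc : Continuous fun y : ℝ => r y * A ξ y * Complex.exp (-(2 * Complex.I * ξ * y)) := by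
    have := h.rc; have := h.Ac ξ; fun_prop
  have := intervalIntegral.integral_eq_sub_of_hasDerivAt (a := -Tm) (b := t)
    (fun y _ => h.hB ξ y) (hc.intervalIntegrable _ _)
  simp only [← mul_assoc]
  rw [this, h.hB0]; ring

lemma int_mod (φ : ℝ → ℂ) (hφ : Integrable φ) (g : ℝ → ℂ) (hg : Continuous g) (h1 : ∀ ξ, ‖g ξ‖ ≤ 1) :
    Integrable (fun ξ => φ ξ * g ξ) :=
  hφ.mul_bdd (c := 1) hg.aestronglyMeasurable (Eventually.of_forall h1)

lemma spec (h : ZSys Tm K q r A B) (n : ℕ) :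
    (∀ t, -Tm ≤ t → ∀ φ : ℝ → ℂ, Integrable φ →
      (∀ τ ∈ Icc 0 (2 * (t + Tm)), ∫ ξ : ℝ, φ ξ * Complex.exp (I * ξ * τ) = 0) →
      ‖∫ ξ : ℝ, φ ξ * A ξ t‖ ≤ K ^ n * (t + Tm) ^ n / n.factorial * ∫ ξ : ℝ, ‖φ ξ‖) ∧
    (∀ t, -Tm ≤ t → ∀ φ : ℝ → ℂ, Integrable φ →
      (∀ τ ∈ Icc (-(2 * t)) (2 * Tm), ∫ ξ : ℝ, φ ξ * Complex.exp (I * ξ * τ) = 0) →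
      ‖∫ ξ : ℝ, φ ξ * B ξ t‖ ≤ K ^ n * (t + Tm) ^ n / n.factorial * ∫ ξ : ℝ, ‖φ ξ‖) := by
  induction n with
  | zero =>
    have key : ∀ φ g : ℝ → ℂ, Integrable φ → (∀ ξ, ‖g ξ‖ ≤ 1) →
        ‖∫ ξ : ℝ, φ ξ * g ξ‖ ≤ ∫ ξ : ℝ, ‖φ ξ‖ := fun φ g hφ hg => by
      refine norm_integral_le_of_norm_le hφ.norm (Eventually.of_forall fun ξ => ?_)
      rw [norm_mul]
      exact mul_le_of_le_one_right (norm_nonneg _) (hg ξ)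
    constructor
    · intro t ht φ hφ _
      simpa using key φ _ hφ (fun ξ => h.A1 ξ t)
    · intro t ht φ hφ _
      simpa using key φ _ hφ (fun ξ => h.B1 ξ t)
  | succ n ih =>
    obtain ⟨ihA, ihB⟩ := ih
    have hem : Continuous fun p : ℝ × ℝ => Complex.exp (2 * Complex.I * p.2 * p.1) := by fun_prop
    have hem' : Continuous fun p : ℝ × ℝ => Complex.exp (-(2 * Complex.I * p.2 * p.1)) := by fun_prop
    constructor
    · intro t ht φ hφ hsp
      have h0 : ∫ ξ : ℝ, φ ξ = 0 := by
        have := hsp 0 ⟨le_rfl, by linarith⟩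
        simpa using this
      have e : ∫ ξ : ℝ, φ ξ * A ξ t = ∫ ξ : ℝ, φ ξ *
          ∫ y in (-Tm)..t, q y * (B ξ y * Complex.exp (2 * Complex.I * ξ * y)) := by
        have e1 : ∀ ξ, φ ξ * ∫ y in (-Tm)..t, q y * (B ξ y * Complex.exp (2 * Complex.I * ξ * y))
            = φ ξ * A ξ t - φ ξ := fun ξ => by rw [h.A_int ξ t]; ring
        simp only [e1]
        rw [integral_sub (int_mod φ hφ _ (h.Acξ t) (fun ξ => h.A1 ξ t)) hφ, h0, sub_zero]
      rw [e]
      refine spec_step φ hφ q h.hqc h.hK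
        (fun ξ y => B ξ y * Complex.exp (2 * Complex.I * ξ * y)) (h.Bmeas.mul hem.measurable)
        (fun ξ y => by rw [norm_mul, zs_norm_exp, mul_one]; exact h.B1 ξ y) t ht n _ ?_
      intro y hy
      have := ihB y hy.1 (fun ξ => φ ξ * Complex.exp (2 * Complex.I * ξ * y))
        (int_mod φ hφ _ (by fun_prop) (fun ξ => (zs_norm_exp ξ y).le)) ?_
      · simp only [norm_mul, zs_norm_exp, mul_one] at this ⊢
        convert this using 4
        ring
      · intro τ hτ
        rw [← hsp (τ + 2 * y) ⟨by linarith [hτ.1], by linarith [hτ.2, hy.2]⟩]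
        congr 1; ext ξ
        rw [mul_assoc, ← Complex.exp_add]
        congr 2; push_cast; ring
    · intro t ht φ hφ hsp
      simp only [h.B_int _ t]
      refine spec_step φ hφ r h.rc h.hKr
        (fun ξ y => A ξ y * Complex.exp (-(2 * Complex.I * ξ * y))) (h.Ameas.mul hem'.measurable)
        (fun ξ y => by rw [norm_mul, zs_norm_exp', mul_one]; exact h.A1 ξ y) t ht n _ ?_
      intro y hy
      have := ihA y hy.1 (fun ξ => φ ξ * Complex.exp (-(2 * Complex.I * ξ * y)))
        (int_mod φ hφ _ (by fun_prop) (fun ξ => (zs_norm_exp' ξ y).le)) ?_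
      · simp only [norm_mul, zs_norm_exp', mul_one] at this ⊢
        convert this using 4
        ring
      · intro τ hτ
        rw [← hsp (τ - 2 * y) ⟨by linarith [hτ.1, hy.2], by linarith [hτ.2]⟩]
        congr 1; ext ξ
        rw [mul_assoc, ← Complex.exp_add]
        congr 2; push_cast; ring

lemma spec_zero (h : ZSys Tm K q r A B) (t : ℝ) (ht : -Tm ≤ t) (φ : ℝ → ℂ) (hφ : Integrable φ)
    (hsp : ∀ τ ∈ Icc (-(2 * t)) (2 * Tm), ∫ ξ : ℝ, φ ξ * Complex.exp (I * ξ * τ) = 0) :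
    ∫ ξ : ℝ, φ ξ * B ξ t = 0 := by
  have h1 : Tendsto (fun n : ℕ => K ^ n * (t + Tm) ^ n / n.factorial * ∫ ξ : ℝ, ‖φ ξ‖) atTop
      (nhds 0) := by
    have := (FloorSemiring.tendsto_pow_div_factorial_atTop (K * (t + Tm))).mul_const
      (∫ ξ : ℝ, ‖φ ξ‖)
    simpa [mul_pow] using this
  have h2 := ge_of_tendsto' h1 (fun n => (h.spec n).2 t ht φ hφ hsp)
  exact norm_le_zero_iff.1 h2

lemma edge_zero {Tp : ℝ} (R : ℝ → ℂ) (hc : Continuous R) (hR : ∀ t, t ∉ Icc (-Tm) Tp → R t = 0) :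
    R (-Tm) = 0 ∧ R Tp = 0 := by
  have hcl : IsClosed {t | R t = 0} := isClosed_eq hc continuous_const
  constructor
  · have : Iio (-Tm) ⊆ {t | R t = 0} := fun t ht => hR t (fun h => not_lt.2 h.1 ht)
    have h2 := closure_minimal this hcl
    rw [closure_Iio] at h2
    exact h2 (mem_Iic.2 le_rfl)
  · have : Ioi Tp ⊆ {t | R t = 0} := fun t ht => hR t (fun h => not_lt.2 h.2 ht)
    have h2 := closure_minimal this hcl
    rw [closure_Ioi] at h2
    exact h2 (mem_Ici.2 le_rfl)

lemma hasDeriv_exp' (ξ t : ℝ) : HasDerivAt (fun t : ℝ => Complex.exp (-(2 * Complex.I * ξ * t)))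
    (-(2 * Complex.I * ξ) * Complex.exp (-(2 * Complex.I * ξ * t))) t := by
  have h1 : HasDerivAt (fun t : ℝ => -(2 * Complex.I * ξ * (t : ℂ))) (-(2 * Complex.I * ξ)) t := by
    have := ((Complex.ofRealCLM.hasDerivAt (x := t)).const_mul (2 * Complex.I * (ξ : ℂ))).neg
    refine (this.congr_deriv ?_)
    simp
  have := h1.cexp
  exact this.congr_deriv (mul_comm _ _)

lemma exp_cancel (ξ t : ℝ) : Complex.exp (2 * Complex.I * ξ * t) *
    Complex.exp (-(2 * Complex.I * ξ * t)) = 1 := by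
  rw [← Complex.exp_add]; simp

lemma ibp (h : ZSys Tm K q r A B) (Tp : ℝ) (F F' G : ℝ → ℂ)
    (hF : ∀ t, HasDerivAt F (F' t) t) (hF'c : Continuous F') (hF0 : F (-Tm) = 0) (hF1 : F Tp = 0)
    (hG : ∀ t, HasDerivAt G (-(F t * q t)) t) (hG1 : G Tp = 0) (ξ : ℝ) :
    (2 * Complex.I * ξ) * ∫ t in (-Tm)..Tp, F t * (A ξ t * Complex.exp (-(2 * Complex.I * ξ * t))) =
    ∫ t in (-Tm)..Tp, (F' t + r t * G t) * (A ξ t * Complex.exp (-(2 * Complex.I * ξ * t))) := by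
  have hFc : Continuous F := continuous_iff_continuousAt.2 fun t => (hF t).continuousAt
  have hGc : Continuous G := continuous_iff_continuousAt.2 fun t => (hG t).continuousAt
  have hAc := h.Ac ξ
  have hrc := h.rc
  have hd : ∀ t, HasDerivAt (fun t : ℝ => F t * (A ξ t * Complex.exp (-(2 * Complex.I * ξ * t))) +
      G t * B ξ t) ((F' t + r t * G t) * (A ξ t * Complex.exp (-(2 * Complex.I * ξ * t))) -
      (2 * Complex.I * ξ) * (F t * (A ξ t * Complex.exp (-(2 * Complex.I * ξ * t))))) t := fun t => by
    refine (((hF t).mul ((h.hA ξ t).mul (hasDeriv_exp' ξ t))).add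
      ((hG t).mul (h.hB ξ t))).congr_deriv ?_
    simp only [Pi.mul_apply]
    linear_combination (F t * q t * B ξ t) * exp_cancel ξ t
  have c1 : Continuous fun t : ℝ =>
      (F' t + r t * G t) * (A ξ t * Complex.exp (-(2 * Complex.I * ξ * t))) := by fun_prop
  have c2 : Continuous fun t : ℝ =>
      (2 * Complex.I * ξ) * (F t * (A ξ t * Complex.exp (-(2 * Complex.I * ξ * t)))) := by fun_prop
  have e := intervalIntegral.integral_eq_sub_of_hasDerivAt (a := -Tm) (b := Tp)
    (fun t _ => hd t) ((c1.sub c2).intervalIntegrable _ _)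
  rw [intervalIntegral.integral_sub (c1.intervalIntegrable _ _) (c2.intervalIntegrable _ _),
    intervalIntegral.integral_const_mul] at e
  simp only [hF0, hF1, hG1, h.hB0] at e
  linear_combination -e

lemma exists_R (h : ZSys Tm K q r A B) (Tp : ℝ) (N : ℕ) (hq : ContDiff ℝ N q) (hrd : ContDiff ℝ N r)
    (hr0 : ∀ t, t ∉ Icc (-Tm) Tp → r t = 0) (k : ℕ) :
    ∀ n : ℕ, k + n = N → ∃ R : ℝ → ℂ, ContDiff ℝ n R ∧ (∀ t, t ∉ Icc (-Tm) Tp → R t = 0) ∧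
      ∀ ξ : ℝ, (2 * Complex.I * ξ) ^ k * B ξ Tp =
        ∫ t in (-Tm)..Tp, R t * (A ξ t * Complex.exp (-(2 * Complex.I * ξ * t))) := by
  induction k with
  | zero =>
    intro n hn
    have : n = N := by omega
    subst this
    refine ⟨r, hrd, hr0, fun ξ => ?_⟩
    rw [pow_zero, one_mul, h.B_int]
  | succ k ih =>
    intro n hn
    obtain ⟨R, hR, hR0, hRi⟩ := ih (n + 1) (by omega)
    have hRn : ContDiff ℝ n R := hR.of_le (by exact_mod_cast Nat.le_succ n)
    have hqn : ContDiff ℝ n q := hq.of_le (by exact_mod_cast (by omega : n ≤ N))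
    have hrn : ContDiff ℝ n r := hrd.of_le (by exact_mod_cast (by omega : n ≤ N))
    have hRq : Continuous fun t => R t * q t := hR.continuous.mul h.hqc
    set G : ℝ → ℂ := fun s => -∫ t in Tp..s, R t * q t with hGdef
    have hG : ∀ t, HasDerivAt G (-(R t * q t)) t := fun t =>
      (hRq.integral_hasStrictDerivAt Tp t).hasDerivAt.neg
    have hGn : ContDiff ℝ n G := by
      have h1 : ContDiff ℝ (n + 1 : ℕ) G := by
        rw [Nat.cast_add, Nat.cast_one, contDiff_succ_iff_deriv]
        refine ⟨fun t => (hG t).differentiableAt, by simp, ?_⟩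
        have : deriv G = fun t => -(R t * q t) := funext fun t => (hG t).deriv
        rw [this]
        exact (hRn.mul hqn).neg
      exact h1.of_le (by exact_mod_cast Nat.le_succ n)
    have hR' : ContDiff ℝ (n + 1) R := by exact_mod_cast hR
    have hdR : ContDiff ℝ n (deriv R) := (contDiff_succ_iff_deriv.1 hR').2.2
    obtain ⟨hb0, hb1⟩ := edge_zero R hR.continuous hR0
    refine ⟨fun t => deriv R t + r t * G t, hdR.add (hrn.mul hGn), fun t ht => ?_, fun ξ => ?_⟩
    · have hev : R =ᶠ[nhds t] fun _ => 0 := by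
        filter_upwards [isClosed_Icc.isOpen_compl.mem_nhds ht] with s hs using hR0 s hs
      have h1 : deriv R t = 0 := by rw [hev.deriv_eq]; simp
      simp [h1, hr0 t ht]
    · rw [pow_succ', mul_assoc, hRi ξ]
      exact h.ibp Tp R (deriv R) G
        (fun t => ((contDiff_succ_iff_deriv.1 hR').1 t).hasDerivAt) hdR.continuous hb0 hb1 hG
        (by simp [hGdef]) ξ

lemma B_decay (h : ZSys Tm K q r A B) (Tp K1 : ℝ) (r' : ℝ → ℂ) (hr' : ∀ t, HasDerivAt r (r' t) t)
    (hr'c : Continuous r') (hK1 : ∀ t, ‖r' t‖ ≤ K1) (hr0 : r (-Tm) = 0) (ξ t : ℝ)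
    (ht : t ∈ Icc (-Tm) Tp) :
    2 * |ξ| * ‖B ξ t‖ ≤ K + (K1 + K * K) * (Tp + Tm) := by
  have hAc := h.Ac ξ
  have hBc := h.Bc ξ
  have hrc := h.rc
  have hqc := h.hqc
  have hK0 := h.K0
  have hd : ∀ t, HasDerivAt (fun t : ℝ => r t * (A ξ t * Complex.exp (-(2 * Complex.I * ξ * t))) +
      (2 * Complex.I * ξ) * B ξ t) (r' t * (A ξ t * Complex.exp (-(2 * Complex.I * ξ * t))) +
      r t * q t * B ξ t) t := fun t => by
    refine (((hr' t).mul ((h.hA ξ t).mul (hasDeriv_exp' ξ t))).add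
      ((h.hB ξ t).const_mul (2 * Complex.I * (ξ : ℂ)))).congr_deriv ?_
    simp only [Pi.mul_apply]
    linear_combination (r t * q t * B ξ t) * exp_cancel ξ t
  have c1 : Continuous fun t : ℝ => r' t * (A ξ t * Complex.exp (-(2 * Complex.I * ξ * t))) +
      r t * q t * B ξ t := by fun_prop
  have e := intervalIntegral.integral_eq_sub_of_hasDerivAt (a := -Tm) (b := t)
    (fun t _ => hd t) (c1.intervalIntegrable _ _)
  simp only [hr0, h.hB0] at e
  have hb := intervalIntegral.norm_integral_le_of_norm_le_const (a := -Tm) (b := t)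
    (f := fun t : ℝ => r' t * (A ξ t * Complex.exp (-(2 * Complex.I * ξ * t))) +
      r t * q t * B ξ t) (C := K1 + K * K) (fun s _ => by
    refine (norm_add_le _ _).trans ?_
    simp only [norm_mul, zs_norm_exp', mul_one]
    have h1 := h.A1 ξ s
    have h2 := h.B1 ξ s
    have h3 := h.hK s
    have h4 := h.hKr s
    have h5 := hK1 s
    have : 0 ≤ K1 := (norm_nonneg _).trans h5
    calc _ ≤ K1 * 1 + K * K * 1 := by gcongr
      _ = _ := by ring)
  have e2 : (2 * Complex.I * ξ) * B ξ t = (∫ s in (-Tm)..t,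
      (r' s * (A ξ s * Complex.exp (-(2 * Complex.I * ξ * s))) + r s * q s * B ξ s)) -
      r t * (A ξ t * Complex.exp (-(2 * Complex.I * ξ * t))) := by
    rw [e]; ring
  have e3 : 2 * |ξ| * ‖B ξ t‖ = ‖(2 * Complex.I * ξ) * B ξ t‖ := by
    simp [norm_mul]
  rw [e3, e2]
  refine (norm_sub_le _ _).trans ?_
  have h6 : ‖r t * (A ξ t * Complex.exp (-(2 * Complex.I * ξ * t)))‖ ≤ K := by
    simp only [norm_mul, zs_norm_exp', mul_one]
    calc _ ≤ K * 1 := by gcongr; exact h.hKr t; exact h.A1 ξ t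
      _ = K := mul_one _
  have h7 : |t - -Tm| ≤ Tp + Tm := by
    rw [abs_of_nonneg (by linarith [ht.1])]; linarith [ht.2]
  have h8 : 0 ≤ K1 := (norm_nonneg _).trans (hK1 0)
  have h9 : (K1 + K * K) * |t - -Tm| ≤ (K1 + K * K) * (Tp + Tm) := by gcongr
  linarith

lemma A_decay (h : ZSys Tm K q r A B) (Tp C : ℝ) (ξ t : ℝ)
    (hC : ∀ t ∈ Icc (-Tm) Tp, 2 * |ξ| * ‖B ξ t‖ ≤ C) (ht : t ∈ Icc (-Tm) Tp) :
    2 * |ξ| * ‖A ξ t - 1‖ ≤ K * C * (Tp + Tm) := by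
  have hK0 := h.K0
  have hC0 : 0 ≤ C := le_trans (by positivity) (hC t ht)
  have e : (2 * |ξ| : ℂ) * (A ξ t - 1) = ∫ y in (-Tm)..t, (2 * |ξ| : ℂ) *
      (q y * (B ξ y * Complex.exp (2 * Complex.I * ξ * y))) := by
    rw [intervalIntegral.integral_const_mul, h.A_int ξ t]; ring
  have e2 : 2 * |ξ| * ‖A ξ t - 1‖ = ‖(2 * |ξ| : ℂ) * (A ξ t - 1)‖ := by simp [norm_mul]
  rw [e2, e]
  refine (intervalIntegral.norm_integral_le_of_norm_le_const (C := K * C) ?_).trans ?_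
  · intro s hs
    rw [uIoc_of_le ht.1] at hs
    have := hC s ⟨hs.1.le, hs.2.trans ht.2⟩
    simp only [norm_mul, zs_norm_exp, mul_one]
    have e3 : ‖(2 : ℂ)‖ * ‖((|ξ| : ℝ) : ℂ)‖ = 2 * |ξ| := by simp
    rw [e3]
    calc _ = ‖q s‖ * (2 * |ξ| * ‖B ξ s‖) := by ring
      _ ≤ _ := by gcongr; exact h.hK s
  · have h7 : |t - -Tm| ≤ Tp + Tm := by
      rw [abs_of_nonneg (by linarith [ht.1])]; linarith [ht.2]
    gcongr

open scoped FourierTransform in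
lemma b_integrable (h : ZSys Tm K q r A B) (Tp : ℝ) (hTp : 0 ≤ Tp) (m : ℕ)
    (hq : ContDiff ℝ (m + 1 : ℕ) q) (hrd : ContDiff ℝ (m + 1 : ℕ) r)
    (hr0 : ∀ t, t ∉ Icc (-Tm) Tp → r t = 0) (k : ℕ) (hk : k ≤ m) :
    Integrable (fun ξ : ℝ => ‖ξ‖ ^ k * ‖B ξ Tp‖) := by
  have hle : -Tm ≤ Tp := by linarith [h.hTm]
  obtain ⟨R, hR, hR0, hRi⟩ := h.exists_R Tp (m + 1) hq hrd hr0 (m + 1) 0 (by omega)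
  have hRc : Continuous R := hR.continuous
  have hcs : ∀ f : ℝ → ℂ, (∀ t, t ∉ Icc (-Tm) Tp → f t = 0) → HasCompactSupport f :=
    fun f hf => HasCompactSupport.intro isCompact_Icc hf
  obtain ⟨KR, hKR⟩ := (hcs R hR0).exists_bound_of_continuous hRc
  have hrd1 : ContDiff ℝ (m + 1) r := by exact_mod_cast hrd
  have hdr := contDiff_succ_iff_deriv.1 hrd1
  have hdr0 : ∀ t, t ∉ Icc (-Tm) Tp → deriv r t = 0 := fun t ht => by
    have hev : r =ᶠ[nhds t] fun _ => 0 := by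
      filter_upwards [isClosed_Icc.isOpen_compl.mem_nhds ht] with s hs using hr0 s hs
    rw [hev.deriv_eq]; simp
  obtain ⟨K1, hK1⟩ := (hcs _ hdr0).exists_bound_of_continuous hdr.2.2.continuous
  set C := K + (K1 + K * K) * (Tp + Tm) with hC
  set D := KR * (K * C * (Tp + Tm)) * (Tp + Tm) with hD
  have hAd : ∀ ξ, ∀ t ∈ Icc (-Tm) Tp, 2 * |ξ| * ‖A ξ t - 1‖ ≤ K * C * (Tp + Tm) :=
    fun ξ t ht => h.A_decay Tp C ξ t (fun t ht => h.B_decay Tp K1 (deriv r)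
      (fun t => (hdr.1 t).hasDerivAt) hdr.2.2.continuous hK1
      (edge_zero r h.rc hr0).1 ξ t ht) ht
  have hKR0 : 0 ≤ KR := (norm_nonneg _).trans (hKR 0)
  have hD0 : 0 ≤ D := by
    have : 0 ≤ K * C * (Tp + Tm) := le_trans (by positivity) (hAd 0 Tp ⟨hle, le_rfl⟩)
    have := h.hTm
    positivity
  have hfour : ∀ ξ : ℝ, ∫ t in (-Tm)..Tp, R t * Complex.exp (-(2 * Complex.I * ξ * t)) =
      𝓕 R (ξ / Real.pi) := fun ξ => by
    rw [Real.fourier_real_eq_integral_exp_smul, intervalIntegral.integral_of_le hle,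
      setIntegral_eq_integral_of_forall_compl_eq_zero]
    · congr 1; ext t
      rw [smul_eq_mul, mul_comm]
      congr 2
      have : (Real.pi : ℂ) ≠ 0 := by exact_mod_cast Real.pi_ne_zero
      push_cast
      field_simp
    · intro t ht
      have : R t = 0 := by
        by_cases h1 : t = -Tm
        · rw [h1]; exact (edge_zero R hRc hR0).1
        · exact hR0 t fun h2 => ht ⟨lt_of_le_of_ne h2.1 (Ne.symm h1), h2.2⟩
      rw [this, zero_mul]
  have hmain : ∀ ξ : ℝ, 2 * |ξ| * ((2 * |ξ|) ^ (m + 1) * ‖B ξ Tp‖) ≤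
      2 * |ξ| * ‖𝓕 R (ξ / Real.pi)‖ + D := fun ξ => by
    have hAc := h.Ac ξ
    have e1 : (2 * |ξ|) ^ (m + 1) * ‖B ξ Tp‖ = ‖(2 * Complex.I * ξ) ^ (m + 1) * B ξ Tp‖ := by
      simp [norm_mul, norm_pow]
    have c1 : Continuous fun t : ℝ => R t * Complex.exp (-(2 * Complex.I * ξ * t)) := by fun_prop
    have c2 : Continuous fun t : ℝ =>
      R t * ((A ξ t - 1) * Complex.exp (-(2 * Complex.I * ξ * t))) := by fun_prop
    have e2 : (2 * Complex.I * ξ) ^ (m + 1) * B ξ Tp = 𝓕 R (ξ / Real.pi) +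
        ∫ t in (-Tm)..Tp, R t * ((A ξ t - 1) * Complex.exp (-(2 * Complex.I * ξ * t))) := by
      rw [hRi ξ, ← hfour, ← intervalIntegral.integral_add (c1.intervalIntegrable _ _)
        (c2.intervalIntegrable _ _)]
      congr 1; ext t; ring
    have e3 : 2 * |ξ| * ‖∫ t in (-Tm)..Tp,
        R t * ((A ξ t - 1) * Complex.exp (-(2 * Complex.I * ξ * t)))‖ ≤ D := by
      have e4 : 2 * |ξ| * ‖∫ t in (-Tm)..Tp,
        R t * ((A ξ t - 1) * Complex.exp (-(2 * Complex.I * ξ * t)))‖ = ‖∫ t in (-Tm)..Tp,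
        (2 * |ξ| : ℂ) * (R t * ((A ξ t - 1) * Complex.exp (-(2 * Complex.I * ξ * t))))‖ := by
        rw [intervalIntegral.integral_const_mul, norm_mul]; simp
      rw [e4]
      refine (intervalIntegral.norm_integral_le_of_norm_le_const
        (C := KR * (K * C * (Tp + Tm))) ?_).trans ?_
      · intro s hs
        rw [uIoc_of_le hle] at hs
        have := hAd ξ s ⟨hs.1.le, hs.2⟩
        simp only [norm_mul, zs_norm_exp', mul_one]
        have e3 : ‖(2 : ℂ)‖ * ‖((|ξ| : ℝ) : ℂ)‖ = 2 * |ξ| := by simp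
        rw [e3]
        calc _ = ‖R s‖ * (2 * |ξ| * ‖A ξ s - 1‖) := by ring
          _ ≤ _ := by gcongr; exact hKR s
      · rw [abs_of_nonneg (by linarith)]
        apply le_of_eq; rw [hD]; ring
    rw [e1, e2]
    have := mul_le_mul_of_nonneg_left (norm_add_le (𝓕 R (ξ / Real.pi)) (∫ t in (-Tm)..Tp,
        R t * ((A ξ t - 1) * Complex.exp (-(2 * Complex.I * ξ * t)))))
        (by positivity : 0 ≤ 2 * |ξ|)
    linarith
  have hL2 : Integrable (fun ξ : ℝ => ‖𝓕 R (ξ / Real.pi)‖ ^ 2) :=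
    (zs_fourier_L2 R hRc (hcs R hR0)).comp_div Real.pi_ne_zero
  have hdom : Integrable (fun ξ : ℝ => ‖𝓕 R (ξ / Real.pi)‖ ^ 2 + (2 + 2 * D) * (1 + ξ ^ 2)⁻¹) :=
    hL2.add (integrable_inv_one_add_sq.const_mul _)
  refine hdom.mono' ?_ (Eventually.of_forall fun ξ => ?_)
  · have := h.Bcξ Tp
    exact Continuous.aestronglyMeasurable (by fun_prop)
  · rw [Real.norm_of_nonneg (by positivity), Real.norm_eq_abs]
    set x := |ξ| with hx
    have hx2 : ξ ^ 2 = x ^ 2 := (sq_abs ξ).symm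
    rw [hx2]
    have hx0 : 0 ≤ x := abs_nonneg ξ
    set ρ := ‖𝓕 R (ξ / Real.pi)‖ with hρ
    have hρ0 : 0 ≤ ρ := norm_nonneg _
    have hB1 := h.B1 ξ Tp
    set β := ‖B ξ Tp‖ with hβ
    have hβ0 : 0 ≤ β := norm_nonneg _
    have hm' := hmain ξ
    rw [← hx, ← hβ, ← hρ] at hm'
    rcases le_total x 1 with h1 | h1
    · have h2 : x ^ k * β ≤ 1 := mul_le_one₀ (pow_le_one₀ hx0 h1) hβ0 hB1
      have h3 : 1 ≤ (2 + 2 * D) * (1 + x ^ 2)⁻¹ := by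
        rw [← div_eq_mul_inv, le_div_iff₀ (by positivity)]
        nlinarith
      nlinarith [sq_nonneg ρ]
    · have hxp : 0 < x := by linarith
      have h2 : x ^ k * β ≤ x ^ m * β := by gcongr
      have h3 : x ^ (m + 1) ≤ (2 * x) ^ (m + 1) := by gcongr; linarith
      have h4 : 2 * x * (x ^ (m + 1) * β) ≤ 2 * x * ρ + D := le_trans (by gcongr) hm'
      have h5 : x ^ 2 * (x ^ m * β) ≤ x * ρ + D / 2 := by
        have : 2 * x * (x ^ (m + 1) * β) = 2 * (x ^ 2 * (x ^ m * β)) := by ring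
        linarith
      have h6 : x * ρ ≤ x ^ 2 * ρ ^ 2 + 1 := by nlinarith [sq_nonneg (x * ρ - 1), sq_nonneg (x * ρ)]
      have h7 : x ^ m * β ≤ ρ ^ 2 + (1 + D) / x ^ 2 := by
        rw [← mul_le_mul_iff_right₀ (by positivity : 0 < x ^ 2)]
        have : x ^ 2 * (ρ ^ 2 + (1 + D) / x ^ 2) = x ^ 2 * ρ ^ 2 + (1 + D) := by field_simp
        rw [this]; linarith
      have h8 : (1 + D) / x ^ 2 ≤ (2 + 2 * D) * (1 + x ^ 2)⁻¹ := by
        rw [← div_eq_mul_inv, div_le_div_iff₀ (by positivity) (by positivity)]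
        nlinarith [mul_nonneg (by linarith : 0 ≤ 1 + D) (by nlinarith : 0 ≤ x ^ 2 - 1)]
      linarith

end ZSys

open scoped FourierTransform in
theorem zs_main
    (Tm Tp K : ℝ) (hTp : 0 ≤ Tp) (m : ℕ) (q r : ℝ → ℂ) (A B : ℝ → ℝ → ℂ)
    (h : ZSys Tm K q r A B)
    (hq : ContDiff ℝ (m + 1 : ℕ) q) (hrd : ContDiff ℝ (m + 1 : ℕ) r)
    (hr0 : ∀ t, t ∉ Icc (-Tm) Tp → r t = 0)
    (β : ℝ → ℂ)
    (hβ : ∀ τ : ℝ, β τ = (1 / (2 * Real.pi)) *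
      ∫ ξ : ℝ, B ξ Tp * Complex.exp (-(Complex.I * ξ * τ))) :
    ContDiff ℝ m β ∧ ∀ τ, τ ∉ Icc (-(2 * Tp)) (2 * Tm) → β τ = 0 := by
  have hbi := h.b_integrable Tp hTp m hq hrd hr0
  have hb : Integrable (fun ξ => B ξ Tp) := by
    have := hbi 0 (Nat.zero_le _)
    simp only [pow_zero, one_mul] at this
    exact (integrable_norm_iff (h.Bcξ Tp).aestronglyMeasurable).1 this
  have hC : ContDiff ℝ m (𝓕 (fun ξ => B ξ Tp)) := by
    have := Real.contDiff_fourier (f := fun ξ => B ξ Tp) (N := (m : ℕ∞))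
      (fun n hn => hbi n (by exact_mod_cast hn))
    exact_mod_cast this
  have hpi : (Real.pi : ℂ) ≠ 0 := by exact_mod_cast Real.pi_ne_zero
  have hβ' : β = fun τ => (1 / (2 * Real.pi) : ℂ) * 𝓕 (fun ξ => B ξ Tp) (τ / (2 * Real.pi)) := by
    ext τ
    rw [hβ τ, Real.fourier_real_eq_integral_exp_smul]
    congr 2
    ext ξ
    rw [smul_eq_mul, mul_comm]
    congr 2
    push_cast
    field_simp
  constructor
  · rw [hβ']
    exact contDiff_const.mul (hC.comp (contDiff_id.div_const _))
  · intro τ hτ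
    rw [hβ']
    have key := zs_fourier_zero (fun ξ => B ξ Tp) hb hC.continuous
      {w : ℝ | w * (2 * Real.pi) ∈ (Icc (-(2 * Tp)) (2 * Tm))ᶜ}
      (isClosed_Icc.isOpen_compl.preimage (by fun_prop))
      (fun φ hφ hw => h.spec_zero Tp (by linarith [h.hTm]) φ hφ (fun τ hτ => by
        have := hw (τ / (2 * Real.pi)) (by
          simp only [mem_compl_iff, mem_ofPred_eq, not_not]
          rwa [div_mul_cancel₀ _ (by positivity)])
        rw [← this]
        congr 1; ext ξ
        congr 2
        push_cast
        field_simp))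
      (τ / (2 * Real.pi)) (by
          simp only [mem_compl_iff, mem_ofPred_eq]
          rwa [div_mul_cancel₀ _ (by positivity)])
    simp only [key, mul_zero]

theorem beta_regularity_from_smooth_potential
    (Tm Tp : ℝ) (hTm : 0 ≤ Tm) (hTp : 0 ≤ Tp)
    (m : ℕ) (hm : 1 ≤ m)
    (q : ℝ → ℂ) (hsmooth : ContDiff ℝ (m + 1 : ℕ) q)
    (hsupp : tsupport q ⊆ Icc (-Tm) Tp)
    (r : ℝ → ℂ) (hr : ∀ t, r t = -(starRingEnd ℂ) (q t))
    (A B : ℂ → ℝ → ℂ)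
    (hA : ∀ ζ t, HasDerivAt (A ζ) (q t * B ζ t * Complex.exp (2 * Complex.I * ζ * t)) t)
    (hB : ∀ ζ t, HasDerivAt (B ζ) (r t * A ζ t * Complex.exp (-(2 * Complex.I * ζ * t))) t)
    (hA0 : ∀ ζ, A ζ (-Tm) = 1) (hB0 : ∀ ζ, B ζ (-Tm) = 0)
    (b : ℂ → ℂ) (hb : ∀ ζ, b ζ = B ζ Tp)
    (β : ℝ → ℂ)
    (hβ : ∀ τ : ℝ, β τ = (1 / (2 * Real.pi)) *
      ∫ ξ : ℝ, b ξ * Complex.exp (-(Complex.I * ξ * τ))) :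
    Function.support β ⊆ Icc (-(2 * Tp)) (2 * Tm)
    ∧ ContDiffOn ℝ (m : ℕ) β (Ioo (-(2 * Tp)) (2 * Tm))
    ∧ ∀ k : ℕ, k ≤ m →
        Tendsto (iteratedDeriv k β) (nhdsWithin (-(2 * Tp)) (Ioi (-(2 * Tp)))) (nhds 0)
        ∧ Tendsto (iteratedDeriv k β) (nhdsWithin (2 * Tm) (Iio (2 * Tm))) (nhds 0) := by
  have hcs : HasCompactSupport q := isCompact_Icc.of_isClosed_subset (isClosed_tsupport q) hsupp
  obtain ⟨K, hK⟩ := hcs.exists_bound_of_continuous hsmooth.continuous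
  have hrfun : r = fun t => -(starRingEnd ℂ) (q t) := funext hr
  have hrd : ContDiff ℝ (m + 1 : ℕ) r := by
    rw [hrfun]
    exact (Complex.conjCLE.contDiff.comp hsmooth).neg
  have hr0 : ∀ t, t ∉ Icc (-Tm) Tp → r t = 0 := fun t ht => by
    have : q t = 0 := image_eq_zero_of_notMem_tsupport fun h => ht (hsupp h)
    rw [hr, this]; simp
  have h : ZSys Tm K q r (fun ξ t => A ξ t) (fun ξ t => B ξ t) :=
    ⟨hTm, hsmooth.continuous, hK, hr, fun ξ t => hA ξ t, fun ξ t => hB ξ t,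
      fun ξ => hA0 ξ, fun ξ => hB0 ξ⟩
  obtain ⟨hC, hz⟩ := zs_main Tm Tp K hTp m q r _ _ h hsmooth hrd hr0 β
    (fun τ => by rw [hβ τ]; simp only [hb])
  refine ⟨fun τ hτ => by_contra fun h => hτ (hz τ h), hC.contDiffOn, fun k hk => ?_⟩
  have hck : Continuous (iteratedDeriv k β) :=
    hC.continuous_iteratedDeriv k (by exact_mod_cast hk)
  have hz' : ∀ τ, τ ∉ Icc (-(2 * Tp)) (2 * Tm) → iteratedDeriv k β τ = 0 := fun τ hτ => by
    have hev : β =ᶠ[nhds τ] fun _ => 0 := by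
      filter_upwards [isClosed_Icc.isOpen_compl.mem_nhds hτ] with s hs using hz s hs
    rw [hev.iteratedDeriv_eq]
    simp
  obtain ⟨e1, e2⟩ := ZSys.edge_zero (Tm := 2 * Tp) (iteratedDeriv k β) hck hz'
  constructor
  · have := hck.tendsto (-(2 * Tp))
    rw [e1] at this
    exact this.mono_left nhdsWithin_le_nhds
  · have := hck.tendsto (2 * Tm)
    rw [e2] at this
    exact this.mono_left nhdsWithin_le_nhds
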